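/- Let d ≥ 2 be an even integer and let n be a positive integer with n ≡ d+1 (mod 2d). Then Σ_{k=0}^{(dn+n−1)/(2d)} [3dk+1]_q · (q; q^{2d})_k (q,q,q^{d−1}; q^d)_k / ((q^d; q^d)_k (q^{2d},q^{2d},q^{d+2}; q^{2d})_k) · q^{d(k²+k)/2} ≡ 0 (mod Φ_n(q)^3). -/

import Mathlib

open Finset

noncomputable section

abbrev R1 : Type := Polynomial ℚ
abbrev K1 : Type := FractionRing R1

/-- The variable `q` as a rational function in `ℚ(q)`. -/
def qv : K1 := algebraMap R1 K1 Polynomial.X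

/-- The q-shifted factorial `(a; q)_k = (1-a)(1-aq)⋯(1-aq^{k-1})`. -/
def qPoch {R : Type*} [CommRing R] (a q : R) (k : ℕ) : R :=
  ∏ j ∈ Finset.range k, (1 - a * q ^ j)

/-- The q-integer `[m]_q = (1 - q^m)/(1 - q)`. -/
def qInt {K : Type*} [Field K] (q : K) (m : ℤ) : K := (1 - q ^ m) / (1 - q)

/-- `A ≡ B (mod M)`: the polynomial `M` divides the numerator of the reduced form
of the rational function `A - B`. -/
def CongrMod1 (A B : K1) (M : R1) : Prop :=
  ∃ f g : R1, g ≠ 0 ∧ (∀ p : R1, Prime p → p ∣ g → ¬ p ∣ M) ∧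
    (A - B) * algebraMap R1 K1 g = algebraMap R1 K1 M * algebraMap R1 K1 f

/-- The numerator over the common denominator `∏_{j<M} δ j` of
`∑_{k=0}^{M} e k * ∏_{j<k} (ν j / δ j)`. -/
def clearedSum {R : Type*} [CommRing R] (e ν δ : ℕ → R) : ℕ → R
  | 0 => e 0
  | M + 1 => clearedSum e ν δ M * δ M + e (M + 1) * ∏ j ∈ range (M + 1), ν j

section ClearedSum

variable {R S : Type*} [CommRing R] [CommRing S]

lemma map_clearedSum (φ : R →+* S) (e ν δ : ℕ → R) (M : ℕ) :
    φ (clearedSum e ν δ M) =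
      clearedSum (fun k => φ (e k)) (fun k => φ (ν k)) (fun k => φ (δ k)) M := by
  induction M with
  | zero => rfl
  | succ M ih => simp [clearedSum, ih, map_prod]

lemma clearedSum_mul (c s : R) (e ν δ : ℕ → R) (M : ℕ) :
    clearedSum (fun k => c * e k) (fun k => s * ν k) (fun k => s * δ k) M =
      c * s ^ M * clearedSum e ν δ M := by
  induction M with
  | zero => simp [clearedSum]
  | succ M ih =>
    simp only [clearedSum, ih, prod_mul_distrib, prod_const, card_range]
    ring

lemma clearedSum_add_of_eq_zero (e ν δ : ℕ → R) {N : ℕ} (hN : ν N = 0) (s : ℕ) :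
    clearedSum e ν δ (N + s) = clearedSum e ν δ N * ∏ j ∈ range s, δ (N + j) := by
  induction s with
  | zero => simp
  | succ s ih =>
    rw [← add_assoc, clearedSum, ih, prod_eq_zero (mem_range.2 (by omega)) hN, prod_range_succ]
    ring

lemma sum_mul_prod_eq_clearedSum {F : Type*} [Field F] (e ν δ : ℕ → F) (M : ℕ)
    (hδ : ∀ j < M, δ j ≠ 0) :
    (∑ k ∈ range (M + 1), e k * ∏ j ∈ range k, (ν j / δ j)) * ∏ j ∈ range M, δ j =
      clearedSum e ν δ M := by
  induction M with
  | zero => simp [clearedSum]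
  | succ M ih =>
    have hne : ∏ j ∈ range (M + 1), δ j ≠ 0 :=
      prod_ne_zero_iff.2 fun j hj => hδ j (mem_range.1 hj)
    rw [sum_range_succ, add_mul, clearedSum, ← ih fun j hj => hδ j (by omega), prod_div_distrib,
      mul_assoc (e (M + 1)), div_mul_cancel₀ _ hne, prod_range_succ δ M]
    ring

end ClearedSum

section QuadraticSummation

variable {R S : Type*} [CommRing R] [CommRing S]

/-- Numerator of the ratio of consecutive terms of the quadratic summation with parameters
`a, b, b'` (where `b * b' = Q`) and `w = 1 / c`. -/
def quadNum (a b b' Q w : R) (j : ℕ) : R :=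
  (1 - a * Q ^ j) * (1 - b * Q ^ j) * (1 - b' * Q ^ j) * (a * Q ^ (j + 1)) * (w - Q ^ (2 * j))

/-- Denominator of the ratio of consecutive terms of the quadratic summation. -/
def quadDen (a b b' Q w : R) (j : ℕ) : R :=
  (1 - Q ^ (2 * j + 2)) * (1 - a * b' * Q ^ (2 * j + 1)) * (1 - a * b * Q ^ (2 * j + 1)) *
    (1 - a * w * Q ^ (j + 1))

/-- The quadratic sum up to `M`, multiplied by its common denominator. -/
def quadSum (a b b' Q w : R) (M : ℕ) : R :=
  clearedSum (fun k => 1 - a * Q ^ (3 * k)) (quadNum a b b' Q w) (quadDen a b b' Q w) M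

lemma map_quadSum (φ : R →+* S) (a b b' Q w : R) (M : ℕ) :
    φ (quadSum a b b' Q w M) = quadSum (φ a) (φ b) (φ b') (φ Q) (φ w) M := by
  rw [quadSum, map_clearedSum]
  simp only [quadSum, quadNum, quadDen, map_sub, map_mul, map_pow, map_one]
  rfl

section Field

variable {F : Type*} [Field F]

/-- The two products in `w` and `w * Q ^ 2` differ by an explicit rational factor. -/
lemma prod_quad_ratio_shift (a b b' Q w : F) (hw : ∀ j, 1 - a * w * Q ^ (j + 1) ≠ 0) (k : ℕ) :
    (∏ j ∈ range k, (quadNum a b b' Q w j / quadDen a b b' Q w j)) *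
        ((Q ^ k) ^ 2 * (w * Q ^ 2 - 1) * (1 - a * w * Q) * (1 - a * w * Q ^ 2)) =
      (∏ j ∈ range k, (quadNum a b b' Q (w * Q ^ 2) j / quadDen a b b' Q (w * Q ^ 2) j)) *
        ((w * Q ^ 2 - (Q ^ k) ^ 2) * (1 - a * w * Q * Q ^ k) * (1 - a * w * Q ^ 2 * Q ^ k)) := by
  induction k with
  | zero => simp
  | succ k ih =>
    have h1 : 1 - a * w * (Q ^ k * Q) ≠ 0 := by simpa [pow_succ] using hw k
    have h3 : 1 - a * (w * Q ^ 2) * (Q ^ k * Q) ≠ 0 := by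
      have := hw (k + 2)
      intro h
      apply this
      rw [← h]
      ring
    rw [prod_range_succ, prod_range_succ]
    set A := ∏ j ∈ range k, (quadNum a b b' Q w j / quadDen a b b' Q w j)
    set B := ∏ j ∈ range k,
      (quadNum a b b' Q (w * Q ^ 2) j / quadDen a b b' Q (w * Q ^ 2) j)
    have hr : quadNum a b b' Q w k / quadDen a b b' Q w k =
        (1 - a * Q ^ k) * (1 - b * Q ^ k) * (1 - b' * Q ^ k) * (a * Q ^ (k + 1)) /
          ((1 - Q ^ (2 * k + 2)) * (1 - a * b' * Q ^ (2 * k + 1)) *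
            (1 - a * b * Q ^ (2 * k + 1))) *
          ((w - (Q ^ k) ^ 2) / (1 - a * w * (Q ^ k * Q))) := by
      rw [quadNum, quadDen, div_mul_div_comm]
      ring_nf
    have hr' : quadNum a b b' Q (w * Q ^ 2) k / quadDen a b b' Q (w * Q ^ 2) k =
        (1 - a * Q ^ k) * (1 - b * Q ^ k) * (1 - b' * Q ^ k) * (a * Q ^ (k + 1)) /
          ((1 - Q ^ (2 * k + 2)) * (1 - a * b' * Q ^ (2 * k + 1)) *
            (1 - a * b * Q ^ (2 * k + 1))) *
          ((w * Q ^ 2 - (Q ^ k) ^ 2) / (1 - a * (w * Q ^ 2) * (Q ^ k * Q))) := by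
      rw [quadNum, quadDen, div_mul_div_comm]
      ring_nf
    rw [hr, hr', pow_succ Q k]
    generalize (1 - a * Q ^ k) * (1 - b * Q ^ k) * (1 - b' * Q ^ k) * (a * (Q ^ k * Q)) /
      ((1 - Q ^ (2 * k + 2)) * (1 - a * b' * Q ^ (2 * k + 1)) *
        (1 - a * b * Q ^ (2 * k + 1))) = X
    generalize Q ^ k = u at *
    have e1 : (w - u ^ 2) / (1 - a * w * (u * Q)) * (1 - a * w * (u * Q)) = w - u ^ 2 :=
      div_mul_cancel₀ _ h1
    have e3 : (w * Q ^ 2 - u ^ 2) / (1 - a * (w * Q ^ 2) * (u * Q)) *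
        (1 - a * (w * Q ^ 2) * (u * Q)) = w * Q ^ 2 - u ^ 2 := div_mul_cancel₀ _ h3
    generalize (w - u ^ 2) / (1 - a * w * (u * Q)) = Y at *
    generalize (w * Q ^ 2 - u ^ 2) / (1 - a * (w * Q ^ 2) * (u * Q)) = Z at *
    linear_combination (X * Y * Q ^ 2) * ih +
      B * X * Q ^ 2 * (w * Q ^ 2 - u ^ 2) * (1 - a * w * Q ^ 2 * u) * e1 -
      B * X * (w * Q ^ 2 - u ^ 2 * Q ^ 2) * (1 - a * w * Q ^ 2 * u) * e3

/-- The partial sums in `w * Q ^ 2` and in `w` differ by an explicit hypergeometric term. -/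
lemma sum_quad_telescope (a b b' Q w : F) (hbb : b * b' = Q) (hQ : Q ≠ 0)
    (hden : ∀ j, (1 - Q ^ (2 * j + 2)) * (1 - a * b' * Q ^ (2 * j + 1)) *
      (1 - a * b * Q ^ (2 * j + 1)) ≠ 0)
    (hw : ∀ j, 1 - a * w * Q ^ (j + 1) ≠ 0)
    (hC : (w * Q ^ 2 - 1) * (1 - a * b' * w * Q) * (1 - a * b * w * Q) ≠ 0) (K : ℕ) :
    ∑ k ∈ range K, ((1 - a * Q ^ (3 * k)) *
        (∏ j ∈ range k, (quadNum a b b' Q (w * Q ^ 2) j / quadDen a b b' Q (w * Q ^ 2) j)) -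
      (1 - a * w * Q) * (1 - a * w * Q ^ 2) / ((1 - a * b' * w * Q) * (1 - a * b * w * Q)) *
      ((1 - a * Q ^ (3 * k)) *
        ∏ j ∈ range k, (quadNum a b b' Q w j / quadDen a b b' Q w j))) =
    (∏ j ∈ range K, (quadNum a b b' Q (w * Q ^ 2) j / quadDen a b b' Q (w * Q ^ 2) j)) *
      ((1 - (Q ^ K) ^ 2) * (Q - a * b' * (Q ^ K) ^ 2) * (Q - a * b * (Q ^ K) ^ 2) *
        (1 - a * w * Q ^ 2 * Q ^ K) * w) /
      ((w * Q ^ 2 - 1) * (1 - a * b' * w * Q) * (1 - a * b * w * Q) * (Q ^ K) ^ 2) := by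
  induction K with
  | zero => simp
  | succ K ih =>
    rw [sum_range_succ, ih, prod_range_succ]
    have hs := prod_quad_ratio_shift a b b' Q w hw K
    set A := ∏ j ∈ range K, (quadNum a b b' Q w j / quadDen a b b' Q w j)
    set B := ∏ j ∈ range K,
      (quadNum a b b' Q (w * Q ^ 2) j / quadDen a b b' Q (w * Q ^ 2) j)
    have h3 : 1 - a * (w * Q ^ 2) * (Q ^ K * Q) ≠ 0 := by
      have := hw (K + 2)
      intro h
      apply this
      rw [← h]
      ring
    have hd := hden K
    have hu : Q ^ K ≠ 0 := pow_ne_zero _ hQ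
    rw [quadNum, quadDen, pow_succ Q K]
    have p1 : Q ^ (2 * K + 2) = (Q ^ K) ^ 2 * Q ^ 2 := by ring
    have p2 : Q ^ (2 * K + 1) = (Q ^ K) ^ 2 * Q := by ring
    have p3 : Q ^ (2 * K) = (Q ^ K) ^ 2 := by ring
    have p4 : Q ^ (3 * K) = (Q ^ K) ^ 3 := by ring
    rw [p1, p2] at hd ⊢
    rw [p3, p4]
    generalize Q ^ K = u at *
    simp only [ne_eq, mul_eq_zero, not_or] at hd hC
    obtain ⟨⟨hd1, hd2⟩, hd3⟩ := hd
    obtain ⟨⟨hC1, hC2⟩, hC3⟩ := hC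
    have hA : A * (1 - a * w * Q) * (1 - a * w * Q ^ 2) = B *
        ((w * Q ^ 2 - u ^ 2) * (1 - a * w * Q * u) * (1 - a * w * Q ^ 2 * u)) /
        (u ^ 2 * (w * Q ^ 2 - 1)) := by
      rw [eq_div_iff (mul_ne_zero (pow_ne_zero _ hu) hC1), ← hs]
      ring
    have hA' : (1 - a * w * Q) * (1 - a * w * Q ^ 2) /
        ((1 - a * b' * w * Q) * (1 - a * b * w * Q)) * ((1 - a * u ^ 3) * A) =
        (1 - a * u ^ 3) * (B *
        ((w * Q ^ 2 - u ^ 2) * (1 - a * w * Q * u) * (1 - a * w * Q ^ 2 * u)) /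
        (u ^ 2 * (w * Q ^ 2 - 1))) / ((1 - a * b' * w * Q) * (1 - a * b * w * Q)) := by
      rw [← hA]
      ring
    rw [hA']
    clear_value A B
    clear hs hA hA' ih hden hw
    have hD : (1 - u ^ 2 * Q ^ 2) * (1 - a * b' * (u ^ 2 * Q)) * (1 - a * b * (u ^ 2 * Q)) *
        (1 - a * (w * Q ^ 2) * (u * Q)) ≠ 0 :=
      mul_ne_zero (mul_ne_zero (mul_ne_zero hd1 hd2) hd3) h3
    have hCu : (w * Q ^ 2 - 1) * (1 - a * b' * w * Q) * (1 - a * b * w * Q) * u ^ 2 ≠ 0 :=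
      mul_ne_zero (mul_ne_zero (mul_ne_zero hC1 hC2) hC3) (pow_ne_zero _ hu)
    have hQ2 : Q ^ 2 ≠ 0 := pow_ne_zero _ hQ
    have hR : ∀ n : F, B * (n / ((1 - u ^ 2 * Q ^ 2) * (1 - a * b' * (u ^ 2 * Q)) *
        (1 - a * b * (u ^ 2 * Q)) * (1 - a * (w * Q ^ 2) * (u * Q)))) *
        ((1 - (u * Q) ^ 2) * (Q - a * b' * (u * Q) ^ 2) * (Q - a * b * (u * Q) ^ 2) *
          (1 - a * w * Q ^ 2 * (u * Q)) * w) /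
        ((w * Q ^ 2 - 1) * (1 - a * b' * w * Q) * (1 - a * b * w * Q) * (u * Q) ^ 2) =
        B * n * w / ((w * Q ^ 2 - 1) * (1 - a * b' * w * Q) * (1 - a * b * w * Q) * u ^ 2) := by
      intro n
      rw [div_eq_div_iff (by rw [mul_pow, ← mul_assoc]; exact mul_ne_zero hCu hQ2) hCu,
        mul_div_assoc', div_mul_eq_mul_div, div_mul_eq_mul_div, div_eq_iff hD]
      ring
    rw [hR, eq_div_iff hCu, add_mul, div_mul_cancel₀ _ hCu, sub_mul ((1 - a * u ^ 3) * B)]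
    have hL : (1 - a * u ^ 3) * (B * ((w * Q ^ 2 - u ^ 2) * (1 - a * w * Q * u) *
        (1 - a * w * Q ^ 2 * u)) / (u ^ 2 * (w * Q ^ 2 - 1))) /
        ((1 - a * b' * w * Q) * (1 - a * b * w * Q)) *
        ((w * Q ^ 2 - 1) * (1 - a * b' * w * Q) * (1 - a * b * w * Q) * u ^ 2) =
        (1 - a * u ^ 3) * (B * ((w * Q ^ 2 - u ^ 2) * (1 - a * w * Q * u) *
        (1 - a * w * Q ^ 2 * u))) := by
      rw [mul_div_assoc', div_div, div_mul_eq_mul_div, div_eq_iff]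
      · ring
      · exact mul_ne_zero (mul_ne_zero (pow_ne_zero _ hu) hC1) (mul_ne_zero hC2 hC3)
    rw [hL]
    subst hbb
    ring

/-- The terminating quadratic summation, `w = Q ^ (2 * M)`. -/
lemma sum_quad_eq (a b b' Q : F) (hbb : b * b' = Q) (hQ : Q ≠ 0)
    (hQ1 : ∀ j : ℕ, 1 - Q ^ (j + 1) ≠ 0) (ha : ∀ j : ℕ, 1 - a * Q ^ (j + 1) ≠ 0)
    (hb' : ∀ j : ℕ, 1 - a * b' * Q ^ (2 * j + 1) ≠ 0)
    (hb : ∀ j : ℕ, 1 - a * b * Q ^ (2 * j + 1) ≠ 0) (M : ℕ) :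
    ∑ k ∈ range (M + 1), (1 - a * Q ^ (3 * k)) *
        ∏ j ∈ range k, (quadNum a b b' Q (Q ^ (2 * M)) j / quadDen a b b' Q (Q ^ (2 * M)) j) =
      (∏ j ∈ range (2 * M + 1), (1 - a * Q ^ j)) /
        ∏ j ∈ range M, ((1 - a * b' * Q ^ (2 * j + 1)) * (1 - a * b * Q ^ (2 * j + 1))) := by
  induction M with
  | zero => simp
  | succ M ih =>
    have hw : ∀ j, 1 - a * Q ^ (2 * M) * Q ^ (j + 1) ≠ 0 := by
      intro j
      rw [mul_assoc, ← pow_add, ← add_assoc]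
      exact ha _
    have hC : (Q ^ (2 * M) * Q ^ 2 - 1) * (1 - a * b' * Q ^ (2 * M) * Q) *
        (1 - a * b * Q ^ (2 * M) * Q) ≠ 0 := by
      rw [mul_assoc (a * b'), mul_assoc (a * b), ← pow_succ, ← pow_add]
      refine mul_ne_zero (mul_ne_zero ?_ (hb' M)) (hb M)
      rw [← neg_ne_zero, neg_sub]
      exact hQ1 (2 * M + 1)
    have key := sum_quad_telescope a b b' Q (Q ^ (2 * M)) hbb hQ
      (fun j => mul_ne_zero (mul_ne_zero (hQ1 (2 * j + 1)) (hb' j)) (hb j)) hw hC (M + 2)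
    rw [sum_sub_distrib, ← mul_sum, sum_range_succ _ (M + 1), sum_range_succ _ (M + 1)] at key
    have hz : ∏ j ∈ range (M + 1),
        (quadNum a b b' Q (Q ^ (2 * M)) j / quadDen a b b' Q (Q ^ (2 * M)) j) = 0 :=
      prod_eq_zero (self_mem_range_succ M) (by simp [quadNum])
    have hz' : ∏ j ∈ range (M + 2), (quadNum a b b' Q (Q ^ (2 * M) * Q ^ 2) j /
        quadDen a b b' Q (Q ^ (2 * M) * Q ^ 2) j) = 0 :=
      prod_eq_zero (self_mem_range_succ (M + 1)) (by simp [quadNum, mul_add, pow_add])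
    rw [hz, hz', mul_zero, zero_mul, zero_div, add_zero, ih, sub_eq_zero] at key
    have hp : Q ^ (2 * (M + 1)) = Q ^ (2 * M) * Q ^ 2 := by ring
    rw [hp, sum_range_succ, key, show 2 * (M + 1) + 1 = 2 * M + 1 + 1 + 1 by ring,
      prod_range_succ _ (2 * M + 1 + 1), prod_range_succ _ (2 * M + 1), prod_range_succ _ M,
      div_mul_div_comm]
    congr 1 <;> ring

lemma quadSum_eq_of_ne_zero (a b b' Q : F) (hbb : b * b' = Q) (hQ : Q ≠ 0)
    (hQ1 : ∀ j : ℕ, 1 - Q ^ (j + 1) ≠ 0) (ha : ∀ j : ℕ, 1 - a * Q ^ (j + 1) ≠ 0)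
    (hb' : ∀ j : ℕ, 1 - a * b' * Q ^ (2 * j + 1) ≠ 0)
    (hb : ∀ j : ℕ, 1 - a * b * Q ^ (2 * j + 1) ≠ 0) (M : ℕ) :
    quadSum a b b' Q (Q ^ (2 * M)) M =
      (∏ j ∈ range (2 * M + 1), (1 - a * Q ^ j)) *
        ∏ j ∈ range M, ((1 - Q ^ (2 * j + 2)) * (1 - a * Q ^ (2 * M) * Q ^ (j + 1))) := by
  have hd : ∀ j < M, quadDen a b b' Q (Q ^ (2 * M)) j ≠ 0 := by
    intro j _
    refine mul_ne_zero (mul_ne_zero (mul_ne_zero (hQ1 (2 * j + 1)) (hb' j)) (hb j)) ?_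
    rw [mul_assoc, ← pow_add, ← add_assoc]
    exact ha _
  have hne : ∏ j ∈ range M, ((1 - a * b' * Q ^ (2 * j + 1)) *
      (1 - a * b * Q ^ (2 * j + 1))) ≠ 0 :=
    prod_ne_zero_iff.2 fun j _ => mul_ne_zero (hb' j) (hb j)
  rw [quadSum, ← sum_mul_prod_eq_clearedSum _ _ _ _ hd, sum_quad_eq a b b' Q hbb hQ hQ1 ha hb' hb,
    div_mul_eq_mul_div, div_eq_iff hne, mul_assoc, ← prod_mul_distrib]
  congr 1
  refine prod_congr rfl fun j _ => ?_
  rw [quadDen]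
  ring

end Field

/-- The terminating quadratic summation in denominator-free form, over any commutative ring. -/
theorem quadSum_eq (a b b' : R) (M : ℕ) :
    quadSum a b b' (b * b') ((b * b') ^ (2 * M)) M =
      (∏ j ∈ range (2 * M + 1), (1 - a * (b * b') ^ j)) *
        ∏ j ∈ range M, ((1 - (b * b') ^ (2 * j + 2)) *
          (1 - a * (b * b') ^ (2 * M) * (b * b') ^ (j + 1))) := by
  let A := MvPolynomial (Fin 3) ℤ
  let x : Fin 3 → A := MvPolynomial.X
  have hx : ∀ i, MvPolynomial.constantCoeff (x i) = 0 := fun i => MvPolynomial.constantCoeff_X _ i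
  have inj : Function.Injective (algebraMap A (FractionRing A)) :=
    IsFractionRing.injective A (FractionRing A)
  have hne : ∀ p : A, MvPolynomial.constantCoeff p = 0 →
      algebraMap A (FractionRing A) (1 - p) ≠ 0 := by
    intro p hp h
    rw [map_eq_zero_iff _ inj] at h
    have := congrArg MvPolynomial.constantCoeff h
    simp [hp] at this
  have generic : quadSum (x 0) (x 1) (x 2) (x 1 * x 2) ((x 1 * x 2) ^ (2 * M)) M =
      (∏ j ∈ range (2 * M + 1), (1 - x 0 * (x 1 * x 2) ^ j)) *
        ∏ j ∈ range M, ((1 - (x 1 * x 2) ^ (2 * j + 2)) *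
          (1 - x 0 * (x 1 * x 2) ^ (2 * M) * (x 1 * x 2) ^ (j + 1))) := by
    apply inj
    rw [map_quadSum]
    have := quadSum_eq_of_ne_zero (algebraMap A (FractionRing A) (x 0))
      (algebraMap A (FractionRing A) (x 1)) (algebraMap A (FractionRing A) (x 2))
      (algebraMap A (FractionRing A) (x 1 * x 2)) (by simp)
      (by
        rw [Ne, map_eq_zero_iff _ inj]
        exact mul_ne_zero (MvPolynomial.X_ne_zero 1) (MvPolynomial.X_ne_zero 2))
      (fun j => by simpa using hne ((x 1 * x 2) ^ (j + 1)) (by simp [hx]))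
      (fun j => by simpa using hne (x 0 * (x 1 * x 2) ^ (j + 1)) (by simp [hx]))
      (fun j => by simpa using hne (x 0 * x 2 * (x 1 * x 2) ^ (2 * j + 1)) (by simp [hx]))
      (fun j => by simpa using hne (x 0 * x 1 * (x 1 * x 2) ^ (2 * j + 1)) (by simp [hx])) M
    rw [map_pow, this]
    simp only [map_mul, map_prod, map_sub, map_one, map_pow]
  let ψ : A →+* R := MvPolynomial.eval₂Hom (Int.castRingHom R) ![a, b, b']
  have h0 : ψ (x 0) = a := MvPolynomial.eval₂_X _ _ 0
  have h1 : ψ (x 1) = b := MvPolynomial.eval₂_X _ _ 1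
  have h2 : ψ (x 2) = b' := MvPolynomial.eval₂_X _ _ 2
  have := congrArg ψ generic
  rw [map_quadSum] at this
  simpa only [map_mul, map_prod, map_sub, map_one, map_pow, h0, h1, h2] using this

end QuadraticSummation

section Vanishing

open Polynomial

variable {F : Type*} [Field F]

/-- The polynomial in `w` whose value at `w` is `quadSum a b b' Q w N`. -/
def quadSumPoly (a b b' Q : F) (N : ℕ) : F[X] := quadSum (C a) (C b) (C b') (C Q) X N

lemma eval_quadSumPoly (a b b' Q w : F) (N : ℕ) :
    (quadSumPoly a b b' Q N).eval w = quadSum a b b' Q w N := by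
  have := map_quadSum (evalRingHom w) (C a) (C b) (C b') (C Q) X N
  simpa [quadSumPoly] using this

lemma eq_of_eval_pow_eq {Q : F} (hQ : Function.Injective fun j : ℕ => Q ^ j) (N : ℕ)
    {p r : F[X]} (h : ∀ s, p.eval (Q ^ (2 * (N + s))) = r.eval (Q ^ (2 * (N + s)))) : p = r := by
  refine eq_of_infinite_eval_eq p r
    (Set.infinite_of_injective_forall_mem (f := fun s : ℕ => Q ^ (2 * (N + s))) ?_ h)
  intro s t hst
  have := hQ hst
  omega

lemma one_sub_pow_ne_zero {Q : F} (hQ : Function.Injective fun j : ℕ => Q ^ j) {j : ℕ}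
    (hj : j ≠ 0) : 1 - Q ^ j ≠ 0 := fun h =>
  hj (hQ (show Q ^ j = Q ^ 0 by rw [pow_zero]; exact (sub_eq_zero.1 h).symm))

lemma quadSum_eq_zero_of_a {a b b' Q : F} (hQ : Function.Injective fun j : ℕ => Q ^ j)
    (hbb : b * b' = Q) {N : ℕ} (hN : a * Q ^ N = 1)
    (hb' : ∀ j : ℕ, 1 - a * b' * Q ^ (2 * j + 1) ≠ 0)
    (hb : ∀ j : ℕ, 1 - a * b * Q ^ (2 * j + 1) ≠ 0) (w : F) (s : ℕ) :
    quadSum a b b' Q w (N + s) = 0 := by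
  have hnum : ∀ w, quadNum a b b' Q w N = 0 := fun w => by simp [quadNum, hN]
  have hp : quadSumPoly a b b' Q N = 0 := by
    refine eq_of_eval_pow_eq hQ N fun s => ?_
    rw [eval_quadSumPoly, eval_zero]
    have h := quadSum_eq a b b' (N + s)
    rw [hbb, prod_eq_zero (i := N) (mem_range.2 (by omega)) (by rw [hN, sub_self]), zero_mul,
      quadSum, clearedSum_add_of_eq_zero _ _ _ (hnum _)] at h
    refine (mul_eq_zero.1 h).resolve_right (prod_ne_zero_iff.2 fun j _ => ?_)
    refine mul_ne_zero (mul_ne_zero (mul_ne_zero ?_ (hb' _)) (hb _)) ?_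
    · exact one_sub_pow_ne_zero hQ (by omega)
    · have : a * Q ^ (2 * (N + s)) * Q ^ (N + j + 1) = Q ^ (2 * (N + s) + j + 1) := by
        linear_combination Q ^ (2 * (N + s) + j + 1) * hN
      rw [this]
      exact one_sub_pow_ne_zero hQ (by omega)
  rw [quadSum, clearedSum_add_of_eq_zero _ _ _ (hnum _), ← quadSum, ← eval_quadSumPoly, hp,
    eval_zero, zero_mul]

lemma prod_range_two_mul_add_one {R : Type*} [CommRing R] (E : ℕ → R) (M : ℕ) :
    ∏ j ∈ range (2 * M + 1), E j =
      (∏ i ∈ range (M + 1), E (2 * i)) * ∏ i ∈ range M, E (2 * i + 1) := by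
  induction M with
  | zero => simp
  | succ M ih =>
    rw [show 2 * (M + 1) + 1 = 2 * M + 1 + 1 + 1 by ring, prod_range_succ, prod_range_succ, ih,
      prod_range_succ (fun i => E (2 * i)) (M + 1), prod_range_succ (fun i => E (2 * i + 1)) M]
    ring_nf

/-- Closed form of the quadratic sum when `b = Q ^ (-(2 * m + 1))` and `w = Q ^ (2 * M)`. -/
lemma quadSum_mul_prod_of_b {a b b' Q : F} (hQ : Function.Injective fun j : ℕ => Q ^ j)
    (hbb : b * b' = Q) {m : ℕ} (hN : b * Q ^ (2 * m + 1) = 1)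
    (ha : ∀ i : ℕ, 1 - a * Q ^ i ≠ 0) (s : ℕ) {w : F} (hw : w = Q ^ (2 * (2 * m + 1 + s))) :
    quadSum a b b' Q w (2 * m + 1) * ∏ i ∈ range (m + 1), (1 - a * w * Q ^ (2 * i + 1)) =
      (∏ i ∈ range (m + 1), (1 - a * Q ^ (2 * i))) *
      (∏ i ∈ range (3 * m + 2), (1 - a * Q ^ (2 * i + 1))) *
      (∏ i ∈ range (m + 1), (1 - a * w * (Q ^ (2 * i) / Q ^ (2 * m)))) *
      ∏ j ∈ range (2 * m + 1), ((1 - Q ^ (2 * j + 2)) * (1 - a * w * Q ^ (j + 1))) := by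
  have hQ0 : Q ≠ 0 := by
    rintro rfl
    exact absurd (hQ (show (0 : F) ^ 1 = 0 ^ 2 by simp)) (by decide)
  have hb'Q : b' = Q ^ (2 * m + 2) := by
    linear_combination Q ^ (2 * m + 1) * hbb - b' * hN
  have hnum : quadNum a b b' Q w (2 * m + 1) = 0 := by simp [quadNum, hN]
  have h := quadSum_eq a b b' (2 * m + 1 + s)
  rw [hbb, ← hw, quadSum, clearedSum_add_of_eq_zero _ _ _ hnum, ← quadSum,
    prod_range_two_mul_add_one (fun j => 1 - a * Q ^ j)] at h
  set f : ℕ → F := fun j => (1 - Q ^ (2 * j + 2)) * (1 - a * w * Q ^ (j + 1)) with hf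
  rw [prod_range_add f (2 * m + 1) s] at h
  have hD : ∀ j, quadDen a b b' Q w (2 * m + 1 + j) = f (2 * m + 1 + j) *
      (1 - a * Q ^ (2 * (m + 1 + j))) * (1 - a * Q ^ (2 * (3 * m + 2 + j) + 1)) := by
    intro j
    have e1 : a * b' * Q ^ (2 * (2 * m + 1 + j) + 1) = a * Q ^ (2 * (3 * m + 2 + j) + 1) := by
      rw [hb'Q]
      ring
    have e2 : a * b * Q ^ (2 * (2 * m + 1 + j) + 1) = a * Q ^ (2 * (m + 1 + j)) := by
      linear_combination a * Q ^ (2 * (m + 1 + j)) * hN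
    rw [quadDen, e1, e2, hf]
    ring
  have hfne : ∀ j, f j ≠ 0 := by
    intro j
    refine mul_ne_zero (one_sub_pow_ne_zero hQ (by omega)) ?_
    rw [hw, mul_assoc, ← pow_add]
    exact ha _
  have hV1 := prod_range_add (fun i => 1 - a * Q ^ (2 * i)) (m + 1) s
  have hV2 := prod_range_add (fun i => 1 - a * Q ^ (2 * i)) (m + 1 + s) (m + 1)
  have hO1 := prod_range_add (fun i => 1 - a * Q ^ (2 * i + 1)) (3 * m + 2) s
  have hO2 := prod_range_add (fun i => 1 - a * Q ^ (2 * i + 1)) (2 * m + 1 + s) (m + 1)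
  have hodd : ∀ i, a * Q ^ (2 * (2 * m + 1 + s + i) + 1) = a * w * Q ^ (2 * i + 1) := by
    intro i
    rw [hw]
    ring
  have heven : ∀ i, a * Q ^ (2 * (m + 1 + s + i)) = a * w * (Q ^ (2 * i) / Q ^ (2 * m)) := by
    intro i
    rw [hw, mul_div_assoc', eq_div_iff (pow_ne_zero _ hQ0)]
    ring
  simp only [hD, prod_mul_distrib] at h
  simp only [hodd, heven] at hO2 hV2
  rw [show m + 1 + s + (m + 1) = 2 * m + 1 + s + 1 by ring] at hV2
  rw [show 2 * m + 1 + s + (m + 1) = 3 * m + 2 + s by ring] at hO2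
  rw [hV2, hV1] at h
  rw [hO1] at hO2
  have n1 : ∏ j ∈ range s, f (2 * m + 1 + j) ≠ 0 := prod_ne_zero_iff.2 fun j _ => hfne _
  have n2 : ∏ j ∈ range s, (1 - a * Q ^ (2 * (m + 1 + j))) ≠ 0 :=
    prod_ne_zero_iff.2 fun j _ => ha _
  have n3 : ∏ j ∈ range s, (1 - a * Q ^ (2 * (3 * m + 2 + j) + 1)) ≠ 0 :=
    prod_ne_zero_iff.2 fun j _ => ha _
  refine mul_right_cancel₀ (mul_ne_zero (mul_ne_zero n1 n2) n3) ?_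
  generalize ∏ j ∈ range s, f (2 * m + 1 + j) = x at *
  generalize ∏ j ∈ range s, (1 - a * Q ^ (2 * (m + 1 + j))) = y₁ at *
  generalize ∏ j ∈ range s, (1 - a * Q ^ (2 * (3 * m + 2 + j) + 1)) = y₂ at *
  generalize ∏ i ∈ range (m + 1), (1 - a * w * (Q ^ (2 * i) / Q ^ (2 * m))) = p₂ at *
  generalize ∏ i ∈ range (m + 1), (1 - a * w * Q ^ (2 * i + 1)) = p₁ at *
  generalize ∏ i ∈ range (2 * m + 1 + s), (1 - a * Q ^ (2 * i + 1)) = o at *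
  generalize ∏ i ∈ range (3 * m + 2), (1 - a * Q ^ (2 * i + 1)) = o' at *
  generalize ∏ i ∈ range (m + 1), (1 - a * Q ^ (2 * i)) = v at *
  generalize quadSum a b b' Q w (2 * m + 1) = U at *
  generalize ∏ j ∈ range (2 * m + 1), f j = F₀ at *
  linear_combination p₁ * h - v * y₁ * p₂ * F₀ * x * hO2

lemma quadSum_eq_zero_of_b {a b b' Q : F} (hQ : Function.Injective fun j : ℕ => Q ^ j)
    (hbb : b * b' = Q) {m : ℕ} (hN : b * Q ^ (2 * m + 1) = 1)
    (ha0 : a ≠ 0) (ha : ∀ i : ℕ, 1 - a * Q ^ i ≠ 0) (s : ℕ) :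
    quadSum a b b' Q a⁻¹ (2 * m + 1 + s) = 0 := by
  have hQ0 : Q ≠ 0 := by
    rintro rfl
    exact absurd (hQ (show (0 : F) ^ 1 = 0 ^ 2 by simp)) (by decide)
  have hp : quadSumPoly a b b' Q (2 * m + 1) *
      ∏ i ∈ range (m + 1), (1 - C a * X * C (Q ^ (2 * i + 1))) =
      C ((∏ i ∈ range (m + 1), (1 - a * Q ^ (2 * i))) *
      (∏ i ∈ range (3 * m + 2), (1 - a * Q ^ (2 * i + 1)))) *
      (∏ i ∈ range (m + 1), (1 - C a * X * C (Q ^ (2 * i) / Q ^ (2 * m)))) *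
      ∏ j ∈ range (2 * m + 1), ((1 - C (Q ^ (2 * j + 2))) * (1 - C a * X * C (Q ^ (j + 1)))) := by
    refine eq_of_eval_pow_eq hQ (2 * m + 1) fun s => ?_
    have := quadSum_mul_prod_of_b hQ hbb hN ha s rfl
    simpa only [eval_mul, eval_quadSumPoly, eval_prod, eval_sub, eval_one, eval_C, eval_X]
      using this
  have hnum : quadNum a b b' Q a⁻¹ (2 * m + 1) = 0 := by simp [quadNum, hN]
  have h := congrArg (eval a⁻¹) hp
  simp only [eval_mul, eval_quadSumPoly, eval_prod, eval_sub, eval_one, eval_C, eval_X,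
    mul_inv_cancel₀ ha0, one_mul] at h
  rw [prod_eq_zero (i := m) (s := range (m + 1)) (f := fun i => 1 - Q ^ (2 * i) / Q ^ (2 * m))
    (by simp) (by rw [div_self (pow_ne_zero _ hQ0), sub_self]), mul_zero, zero_mul] at h
  rw [quadSum, clearedSum_add_of_eq_zero _ _ _ hnum, ← quadSum,
    (mul_eq_zero.1 h).resolve_right
      (prod_ne_zero_iff.2 fun i _ => one_sub_pow_ne_zero hQ (by omega)), zero_mul]

end Vanishing

section Deformation

variable {R S : Type*} [CommRing R] [CommRing S]

/-- Numerator of the term ratio of the sum with deformation parameters `z` and `y`. -/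
def deformNum (d : ℕ) (q z y : R) (j : ℕ) : R :=
  z * (z - q * (q ^ d) ^ j) * (y - q * (q ^ d) ^ j) * (1 - q ^ (d - 1) * y * (q ^ d) ^ j) *
    (q ^ d) ^ (j + 1) * (1 - q * (q ^ d) ^ (2 * j))

/-- Denominator of the term ratio of the sum with deformation parameters `z` and `y`. -/
def deformDen (d : ℕ) (q z y : R) (j : ℕ) : R :=
  (1 - (q ^ d) ^ (2 * j + 2)) * (z - q * q ^ (d - 1) * y * (q ^ d) ^ (2 * j + 1)) *
    (z * y - q * q * (q ^ d) ^ (2 * j + 1)) * (z - (q ^ d) ^ (j + 1))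

/-- The sum with deformation parameters `z` and `y`, multiplied by its common denominator;
the original sum corresponds to `z = y = 1`. -/
def deformSum (d : ℕ) (q z y : R) (M : ℕ) : R :=
  clearedSum (fun k => z - q * (q ^ d) ^ (3 * k)) (deformNum d q z y) (deformDen d q z y) M

lemma map_deformSum (φ : R →+* S) (d : ℕ) (q z y : R) (M : ℕ) :
    φ (deformSum d q z y M) = deformSum d (φ q) (φ z) (φ y) M := by
  rw [deformSum, map_clearedSum]
  simp only [deformSum, deformNum, deformDen, map_sub, map_mul, map_pow, map_one]
  rfl

variable {F : Type*} [Field F]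

lemma deformSum_eq_quadSum (d : ℕ) {q z y : F} (hq : q ≠ 0) (hz : z ≠ 0) (hy : y ≠ 0) (M : ℕ) :
    deformSum d q z y M =
      z * (z ^ 3 * y) ^ M * quadSum (q / z) (q / y) (q ^ (d - 1) * y) (q ^ d) q⁻¹ M := by
  rw [quadSum, ← clearedSum_mul, deformSum]
  congr 1
  · funext k
    field_simp
  · funext j
    rw [deformNum, quadNum]
    generalize q ^ d = Q
    generalize q ^ (d - 1) = p
    field_simp
  · funext j
    rw [deformDen, quadDen]
    generalize q ^ d = Q
    generalize q ^ (d - 1) = p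
    field_simp

lemma div_mul_pow_pred_mul {d : ℕ} (hd : 1 ≤ d) {q y : F} (hy : y ≠ 0) :
    q / y * (q ^ (d - 1) * y) = q ^ d := by
  obtain ⟨e, rfl⟩ := Nat.exists_eq_add_of_le' hd
  rw [Nat.add_sub_cancel]
  field_simp
  ring

lemma pow_mul_prod_range (z : R) (f : ℕ → R) (M : ℕ) :
    z ^ M * ∏ j ∈ range M, f j = ∏ j ∈ range M, (z * f j) := by
  simp [prod_mul_distrib]

lemma deformSum_eq_prod {d : ℕ} (hd : 1 ≤ d) {q z y : F} (hz : z ≠ 0) (hy : y ≠ 0)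
    {M : ℕ} (hM : q * (q ^ d) ^ (2 * M) = 1) :
    deformSum d q z y M = (∏ j ∈ range (2 * M + 1), (z - q * (q ^ d) ^ j)) *
      (∏ j ∈ range M, ((1 - (q ^ d) ^ (2 * j + 2)) * (z - (q ^ d) ^ (j + 1)))) * y ^ M := by
  have hq : q ≠ 0 := left_ne_zero_of_mul_eq_one hM
  have hw : q⁻¹ = (q ^ d) ^ (2 * M) := inv_eq_of_mul_eq_one_right hM
  have h := quadSum_eq (q / z) (q / y) (q ^ (d - 1) * y) M
  rw [div_mul_pow_pred_mul hd hy] at h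
  rw [deformSum_eq_quadSum d hq hz hy, hw, h, ← hw]
  have h1 : ∏ j ∈ range (2 * M + 1), (z - q * (q ^ d) ^ j) =
      z ^ (2 * M + 1) * ∏ j ∈ range (2 * M + 1), (1 - q / z * (q ^ d) ^ j) := by
    rw [pow_mul_prod_range]
    refine prod_congr rfl fun j _ => ?_
    field_simp
  have h2 : ∏ j ∈ range M, ((1 - (q ^ d) ^ (2 * j + 2)) * (z - (q ^ d) ^ (j + 1))) =
      z ^ M * ∏ j ∈ range M, ((1 - (q ^ d) ^ (2 * j + 2)) *
        (1 - q / z * q⁻¹ * (q ^ d) ^ (j + 1))) := by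
    rw [pow_mul_prod_range]
    refine prod_congr rfl fun j _ => ?_
    generalize q ^ d = Q
    field_simp
  rw [h1, h2]
  ring

lemma ne_zero_of_injective_pow {q : F} (hq : Function.Injective fun j : ℕ => q ^ j) : q ≠ 0 := by
  rintro rfl
  exact absurd (hq (show (0 : F) ^ 1 = 0 ^ 2 by simp)) (by decide)

lemma injective_pow_pow {q : F} (hq : Function.Injective fun j : ℕ => q ^ j) {d : ℕ}
    (hd : 0 < d) : Function.Injective fun j : ℕ => (q ^ d) ^ j := by
  intro i j h
  simp only [← pow_mul] at h
  exact Nat.eq_of_mul_eq_mul_left hd (hq h)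

lemma deformSum_pow_one {q : F} (hq : Function.Injective fun j : ℕ => q ^ j) {d n m : ℕ}
    (hd : Even d) (hd0 : 0 < d) (hn : n = d * (2 * m + 1) + 1) (s : ℕ) :
    deformSum d q (q ^ n) 1 (2 * m + 1 + s) = 0 := by
  have hq0 := ne_zero_of_injective_pow hq
  have hqn : q ^ n ≠ 0 := pow_ne_zero _ hq0
  rw [deformSum_eq_quadSum d hq0 hqn one_ne_zero, quadSum_eq_zero_of_a (injective_pow_pow hq hd0)
    (div_mul_pow_pred_mul hd0 one_ne_zero), mul_zero]
  · rw [div_mul_eq_mul_div, div_eq_one_iff_eq hqn, hn]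
    ring
  · intro j h
    rw [sub_eq_zero, mul_one, div_mul_eq_mul_div, mul_pow_sub_one hd0.ne', div_mul_eq_mul_div,
      eq_div_iff hqn, one_mul, ← pow_mul, ← pow_add] at h
    have := hq h
    obtain ⟨e, rfl⟩ := hd
    have h1 : n = 2 * (e * (2 * m + 1)) + 1 := by rw [hn]; ring
    have h2 : n = 2 * (e + e * (2 * j + 1)) := by rw [this]; ring
    omega
  · intro j h
    rw [sub_eq_zero, div_one, div_mul_eq_mul_div, div_mul_eq_mul_div, eq_div_iff hqn, one_mul,
      ← pow_mul, ← pow_two, ← pow_add] at h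
    have := hq h
    obtain ⟨e, rfl⟩ := hd
    have h1 : n = 2 * (e * (2 * m + 1)) + 1 := by rw [hn]; ring
    have h2 : n = 2 * (1 + e * (2 * j + 1)) := by rw [this]; ring
    omega

lemma deformSum_pow_pow {q : F} (hq : Function.Injective fun j : ℕ => q ^ j) {d n m : ℕ}
    (hd0 : 0 < d) (hn : n = d * (2 * m + 1) + 1) (s : ℕ) :
    deformSum d q (q ^ n) (q ^ n) (2 * m + 1 + s) = 0 := by
  have hq0 := ne_zero_of_injective_pow hq
  have hqn : q ^ n ≠ 0 := pow_ne_zero _ hq0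
  rw [deformSum_eq_quadSum d hq0 hqn hqn, quadSum_eq_zero_of_a (injective_pow_pow hq hd0)
    (div_mul_pow_pred_mul hd0 hqn), mul_zero]
  · rw [div_mul_eq_mul_div, div_eq_one_iff_eq hqn, hn]
    ring
  · intro j
    rw [div_mul_pow_pred_mul hd0 hqn, ← pow_succ']
    exact one_sub_pow_ne_zero (injective_pow_pow hq hd0) (by omega)
  · intro j h
    rw [sub_eq_zero, div_mul_div_comm, div_mul_eq_mul_div, eq_div_iff (mul_ne_zero hqn hqn),
      one_mul, ← pow_mul, ← pow_two q, ← pow_add, ← pow_add] at h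
    have := hq h
    have h3 : d * (2 * (2 * m + 1)) = d * (2 * j + 1) := by
      rw [hn] at this
      linarith
    have := Nat.eq_of_mul_eq_mul_left hd0 h3
    omega

lemma deformSum_one_pow {q : F} (hq : Function.Injective fun j : ℕ => q ^ j) {d n m : ℕ}
    (hd0 : 0 < d) (hn : n = d * (2 * m + 1) + 1) (s : ℕ) :
    deformSum d q 1 (q ^ n) (2 * m + 1 + s) = 0 := by
  have hq0 := ne_zero_of_injective_pow hq
  have hqn : q ^ n ≠ 0 := pow_ne_zero _ hq0
  rw [deformSum_eq_quadSum d hq0 one_ne_zero hqn, div_one,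
    quadSum_eq_zero_of_b (injective_pow_pow hq hd0) (div_mul_pow_pred_mul hd0 hqn) _ hq0, mul_zero]
  · intro i
    rw [← pow_mul, ← pow_succ']
    exact one_sub_pow_ne_zero hq (by omega)
  · rw [div_mul_eq_mul_div, div_eq_one_iff_eq hqn, hn]
    ring

end Deformation

section MixedDifference

open Polynomial

/-- A bivariate polynomial that vanishes at `(r, 1)`, `(r, r)` and `(1, r)`, and that modulo the
kernel of `φ` is divisible by the square of `X - 1` in the outer variable, has a value at `(1, 1)`
that is highly divisible. -/
lemma pow_three_dvd_eval {R L : Type*} [CommRing R] [CommRing L] (φ : R →+* L) {π r : R}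
    (hφ : ∀ x, φ x = 0 → π ∣ x) (hr : φ r = 1) (P : R[X][X])
    (h₁ : (P.eval (C r)).eval 1 = 0) (h₂ : (P.eval (C r)).eval r = 0)
    (h₃ : (P.eval 1).eval r = 0)
    (hP : (X - 1) ^ 2 ∣ P.map (mapRingHom φ)) :
    π ^ 3 ∣ (P.eval 1).eval 1 := by
  obtain ⟨H, hH⟩ : (X - C (C r)) ∣ P - C (P.eval (C r)) := X_sub_C_dvd_sub_C_eval
  have hπr : π ∣ 1 - r := hφ _ (by simp [hr])
  obtain ⟨E, hE⟩ := hP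
  have hH1 : (H.eval 1).map φ = 0 := by
    have hm := congrArg (Polynomial.map (mapRingHom φ)) hH
    have hC : (P.eval (C r)).map φ = 0 := by
      have := congrArg (Polynomial.eval 1) hE
      have h1 : (mapRingHom φ) (C r) = (1 : L[X]) := by simp [hr]
      rw [← h1, eval_map_apply] at this
      simpa [hr] using this
    simp only [Polynomial.map_sub, Polynomial.map_mul, map_X, map_C, coe_mapRingHom, hr, hC, hE,
      C_1, C_0, sub_zero] at hm
    have hreg : (X - 1 : L[X][X]) * ((X - 1) * E) = (X - 1) * H.map (mapRingHom φ) := by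
      rw [← hm]
      ring
    have hmon : (X - 1 : L[X][X]).Monic := by simpa using monic_X_sub_C (1 : L[X])
    have hHE := hmon.isRegular.left hreg
    have := congrArg (Polynomial.eval 1) hHE
    have h1 : (mapRingHom φ) 1 = (1 : L[X]) := map_one _
    rw [← h1, eval_map_apply] at this
    simpa using this.symm
  have hdvd : C π ∣ H.eval 1 := by
    rw [C_dvd_iff_dvd_coeff]
    intro i
    refine hφ _ ?_
    rw [← coeff_map, hH1, coeff_zero]
  obtain ⟨K, hK⟩ := hdvd
  have hH' := congrArg (Polynomial.eval 1) hH
  simp only [eval_sub, eval_mul, eval_C, eval_X, hK] at hH'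
  have e1 := congrArg (Polynomial.eval 1) hH'
  have er := congrArg (Polynomial.eval r) hH'
  simp only [eval_sub, eval_mul, eval_C, eval_one, h₁, h₂, h₃, sub_zero] at e1 er
  obtain ⟨c, hc⟩ : 1 - r ∣ K.eval 1 - K.eval r := sub_dvd_eval_sub 1 r K
  obtain ⟨t, ht⟩ := hπr
  refine ⟨t ^ 2 * c, ?_⟩
  rw [e1]
  rw [ht] at er hc ⊢
  linear_combination π * t * π * hc - er

end MixedDifference

section Congruence

open Polynomial

lemma map_deformDen {R S : Type*} [CommRing R] [CommRing S] (φ : R →+* S) (d : ℕ) (q z y : R)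
    (j : ℕ) : φ (deformDen d q z y j) = deformDen d (φ q) (φ z) (φ y) j := by
  simp only [deformDen, map_sub, map_mul, map_pow, map_one]

lemma eval_eval_deformSum {R : Type*} [CommRing R] (d M : ℕ) (q z y : R) :
    ((deformSum d (C (C q)) X (C X) M : R[X][X]).eval (C z)).eval y = deformSum d q z y M := by
  have := map_deformSum ((evalRingHom y).comp (evalRingHom (C z))) d
    (C (C q) : R[X][X]) X (C X) M
  simpa using this

lemma injective_pow_qv : Function.Injective fun j : ℕ => qv ^ j := by
  intro i j h
  simp only [qv, ← map_pow] at h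
  have := congrArg natDegree (IsFractionRing.injective R1 K1 h)
  simpa using this

/-- At a root of unity the deformed sum is divisible by `(X - 1) ^ 2`. -/
lemma X_sub_one_sq_dvd_deformSum {L : Type*} [Field L] {ζ : L} {d m M : ℕ} (hd : 1 ≤ d)
    (hm : ζ * (ζ ^ d) ^ m = 1) (hM : ζ * (ζ ^ d) ^ (2 * M) = 1) (hmM : m < 2 * M) :
    (X - 1) ^ 2 ∣ (deformSum d (C (C ζ)) X (C X) M : L[X][X]) := by
  have hprod : (deformSum d (C (C ζ)) X (C X) M : L[X][X]) =
      (∏ j ∈ range (2 * M + 1), (X - C (C ζ) * (C (C ζ) ^ d) ^ j)) *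
      (∏ j ∈ range M, ((1 - (C (C ζ) ^ d) ^ (2 * j + 2)) * (X - (C (C ζ) ^ d) ^ (j + 1)))) *
      C X ^ M := by
    have inj := IsFractionRing.injective L[X][X] (FractionRing L[X][X])
    apply inj
    rw [map_deformSum, deformSum_eq_prod hd]
    · simp only [map_mul, map_prod, map_sub, map_pow, map_one]
    · rw [Ne, map_eq_zero_iff _ inj]
      exact X_ne_zero
    · rw [Ne, map_eq_zero_iff _ inj]
      exact C_ne_zero.2 X_ne_zero
    · simp only [← map_pow, ← map_mul, hM, map_one]
  rw [hprod, prod_range_succ]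
  refine Dvd.dvd.mul_right (Dvd.dvd.mul_right ?_ _) _
  rw [pow_two]
  refine mul_dvd_mul ((dvd_of_eq ?_).trans (dvd_prod_of_mem _ (mem_range.2 hmM))) (dvd_of_eq ?_)
  · simp only [← map_pow, ← map_mul, hm, map_one]
  · simp only [← map_pow, ← map_mul, hM, map_one]

lemma prod_pow_succ_eq {R : Type*} [CommRing R] (q : R) {d : ℕ} (hd : Even d) (k : ℕ) :
    ∏ j ∈ range k, (q ^ d) ^ (j + 1) = q ^ (d * (k ^ 2 + k) / 2) := by
  obtain ⟨e, rfl⟩ := hd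
  have h : ∀ k, (e + e) * (k ^ 2 + k) / 2 = e * (k ^ 2 + k) := fun k => by
    rw [← two_mul, mul_assoc, Nat.mul_div_cancel_left _ two_pos]
  rw [h]
  induction k with
  | zero => simp
  | succ k ih =>
    rw [prod_range_succ, ih]
    ring

/-- The terms of the sum, written through the term ratio at `z = y = 1`. -/
lemma term_eq {F : Type*} [Field F] (q : F) {d : ℕ} (hd0 : 0 < d) (hd : Even d) (k : ℕ) :
    qInt q (3 * (d : ℤ) * k + 1) * qPoch q (q ^ (2 * d)) k *
        (qPoch q (q ^ d) k * qPoch q (q ^ d) k * qPoch (q ^ (d - 1)) (q ^ d) k) /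
        (qPoch (q ^ d) (q ^ d) k *
          (qPoch (q ^ (2 * d)) (q ^ (2 * d)) k * qPoch (q ^ (2 * d)) (q ^ (2 * d)) k *
            qPoch (q ^ (d + 2)) (q ^ (2 * d)) k)) * q ^ (d * (k ^ 2 + k) / 2) =
      (1 - q * (q ^ d) ^ (3 * k)) *
        (∏ j ∈ range k, (deformNum d q 1 1 j / deformDen d q 1 1 j)) / (1 - q) := by
  have hqInt : qInt q (3 * (d : ℤ) * k + 1) = (1 - q * (q ^ d) ^ (3 * k)) / (1 - q) := by
    rw [qInt, show 3 * (d : ℤ) * k + 1 = ((d * (3 * k) + 1 : ℕ) : ℤ) by push_cast; ring,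
      zpow_natCast, pow_succ', pow_mul]
  have hnum : ∏ j ∈ range k, deformNum d q 1 1 j = qPoch q (q ^ (2 * d)) k *
      (qPoch q (q ^ d) k * qPoch q (q ^ d) k * qPoch (q ^ (d - 1)) (q ^ d) k) *
      q ^ (d * (k ^ 2 + k) / 2) := by
    rw [← prod_pow_succ_eq q hd]
    simp only [qPoch, ← prod_mul_distrib]
    refine prod_congr rfl fun j _ => ?_
    rw [deformNum]
    ring
  have hden : ∏ j ∈ range k, deformDen d q 1 1 j = qPoch (q ^ d) (q ^ d) k *
      (qPoch (q ^ (2 * d)) (q ^ (2 * d)) k * qPoch (q ^ (2 * d)) (q ^ (2 * d)) k *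
        qPoch (q ^ (d + 2)) (q ^ (2 * d)) k) := by
    simp only [qPoch, ← prod_mul_distrib]
    refine prod_congr rfl fun j _ => ?_
    rw [deformDen, mul_pow_sub_one hd0.ne']
    ring
  rw [prod_div_distrib, hnum, hden, hqInt]
  ring

lemma not_dvd_den_exponents {d e m n M : ℕ} (hd : d = 2 * e) (he : 0 < e)
    (hn : n = d * (2 * m + 1) + 1) (hM : M = (d + 1) * m + e + 1) {j : ℕ} (hj : j < M) :
    ¬ n ∣ d * (j + 1) ∧ ¬ n ∣ d * (2 * j + 2) ∧ ¬ n ∣ 2 + d * (2 * j + 1) := by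
  have hodd : Nat.Coprime n 2 := by
    rw [Nat.coprime_two_right, hn, hd, mul_assoc]
    exact ⟨_, rfl⟩
  have hnd : Nat.Coprime n d := by
    rw [hn]
    simp
  have hMn : M < n := by
    rw [hM, hn, hd]
    nlinarith
  have h0 : ¬ n ∣ j + 1 := fun h => by
    have := Nat.le_of_dvd (by omega) h
    omega
  refine ⟨fun h => h0 (hnd.dvd_of_dvd_mul_left h), fun h => h0 ?_, fun h => ?_⟩
  · refine hodd.dvd_of_dvd_mul_left (hnd.dvd_of_dvd_mul_left (h.trans (dvd_of_eq ?_)))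
    ring
  · have h' : n ∣ 2 * (e + 1 + d * j) := h.trans (dvd_of_eq (by rw [hd]; ring))
    obtain ⟨c, hc⟩ := hodd.dvd_of_dvd_mul_left h'
    have hce : e + 1 ≤ c := by
      by_contra hlt
      push Not at hlt
      have hmod : (e + 1) ≡ c [MOD d] := by
        have h1 : e + 1 + d * j ≡ e + 1 [MOD d] := by simp [Nat.ModEq]
        have h2 : n * c ≡ c [MOD d] := by
          have : n ≡ 1 [MOD d] := by simp [hn, Nat.ModEq]
          simpa using this.mul_right c
        exact h1.symm.trans ((Nat.ModEq.refl _).trans (hc ▸ h2))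
      have hdvd := (Nat.modEq_iff_dvd' hlt.le).1 hmod.symm
      have := Nat.le_of_dvd (by omega) hdvd
      have hc0 : c = 0 := by omega
      rw [hc0] at hc
      omega
    have h1 : n * (e + 1) ≤ n * c := Nat.mul_le_mul_left _ hce
    have h2 : d * (j + 1) ≤ d * M := Nat.mul_le_mul_left _ hj
    rw [← hc] at h1
    rw [hM] at h2
    rw [hn, hd] at h1
    rw [hd] at h2
    nlinarith [Nat.zero_le (e * m)]

end Congruence

/-- For even `d ≥ 2` and `n ≡ d+1 (mod 2d)`,
`Σ_{k=0}^{(dn+n-1)/(2d)} [3dk+1] (q;q^{2d})_k (q,q,q^{d-1};q^d)_k /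
((q^d;q^d)_k (q^{2d},q^{2d},q^{d+2};q^{2d})_k) · q^{d(k²+k)/2} ≡ 0 (mod Φ_n(q)^3)`. -/
theorem stmt1 (d : ℕ) (hd2 : 2 ≤ d) (hdeven : Even d) (n : ℕ) (hn : 0 < n)
    (hmod : n % (2 * d) = (d + 1) % (2 * d)) :
    CongrMod1
      (∑ k ∈ Finset.range ((d * n + n - 1) / (2 * d) + 1),
        qInt qv (3 * (d : ℤ) * k + 1) *
          qPoch qv (qv ^ (2 * d)) k *
          (qPoch qv (qv ^ d) k * qPoch qv (qv ^ d) k * qPoch (qv ^ (d - 1)) (qv ^ d) k) /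
          (qPoch (qv ^ d) (qv ^ d) k *
            (qPoch (qv ^ (2 * d)) (qv ^ (2 * d)) k * qPoch (qv ^ (2 * d)) (qv ^ (2 * d)) k *
              qPoch (qv ^ (d + 2)) (qv ^ (2 * d)) k)) *
          qv ^ (d * (k ^ 2 + k) / 2))
      0 (Polynomial.cyclotomic n ℚ ^ 3) := by
  obtain ⟨e, he⟩ := hdeven.two_dvd
  have he0 : 0 < e := by omega
  have hd0 : 0 < d := by omega
  obtain ⟨m, hm⟩ : ∃ m, n = d * (2 * m + 1) + 1 := by
    refine ⟨n / (2 * d), ?_⟩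
    have h := Nat.div_add_mod n (2 * d)
    rw [hmod, Nat.mod_eq_of_lt (by omega : d + 1 < 2 * d)] at h
    linarith
  obtain ⟨M, hM⟩ : ∃ M, M = (d + 1) * m + e + 1 := ⟨_, rfl⟩
  have hexp : 1 + d * (2 * M) = (d + 1) * n := by
    rw [hM, hm, he]
    ring
  have hMdiv : (d * n + n - 1) / (2 * d) = M := by
    have : d * n + n - 1 = 2 * d * M := by
      have : d * n + n = 1 + d * (2 * M) := by rw [hexp]; ring
      rw [this, Nat.add_sub_cancel_left]
      ring
    rw [this, Nat.mul_div_cancel_left _ (by omega)]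
  obtain ⟨s, hs⟩ : ∃ s, M = 2 * m + 1 + s := by
    refine ⟨(d - 1) * m + e, ?_⟩
    obtain ⟨c, rfl⟩ : ∃ c, d = c + 1 := ⟨d - 1, by omega⟩
    rw [hM, Nat.add_sub_cancel]
    ring
  have inj := IsFractionRing.injective R1 K1
  let ζ : ℂ := Complex.exp (2 * Real.pi * Complex.I / n)
  have hζ : IsPrimitiveRoot ζ n := Complex.isPrimitiveRoot_exp n hn.ne'
  let φ : R1 →+* ℂ := (Polynomial.aeval ζ : R1 →ₐ[ℚ] ℂ)
  have hφX : φ Polynomial.X = ζ := Polynomial.aeval_X ζ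
  have hφ : ∀ x, φ x = 0 → Polynomial.cyclotomic n ℚ ∣ x := by
    intro x hx
    rw [Polynomial.cyclotomic_eq_minpoly_rat hζ hn]
    exact minpoly.dvd ℚ ζ hx
  have hφ' : ∀ x, Polynomial.cyclotomic n ℚ ∣ x → φ x = 0 := by
    rintro x ⟨c, rfl⟩
    rw [Polynomial.cyclotomic_eq_minpoly_rat hζ hn, map_mul]
    exact mul_eq_zero_of_left (minpoly.aeval ℚ ζ) _
  have hdvd : Polynomial.cyclotomic n ℚ ^ 3 ∣ deformSum d (Polynomial.X : R1) 1 1 M := by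
    have hval := eval_eval_deformSum d M (Polynomial.X : R1)
    have h := pow_three_dvd_eval φ hφ (r := Polynomial.X ^ n)
      (by rw [map_pow, hφX, hζ.pow_eq_one])
      (deformSum d (Polynomial.C (Polynomial.C Polynomial.X)) Polynomial.X
        (Polynomial.C Polynomial.X) M)
    have hval_one := fun y => hval 1 y
    simp only [Polynomial.C_1] at hval_one
    rw [hval, hval, hval_one, hval_one] at h
    refine h (inj ?_) (inj ?_) (inj ?_) ?_
    · rw [map_deformSum, map_pow, map_one, map_zero, hs]
      exact deformSum_pow_one injective_pow_qv hdeven hd0 hm s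
    · rw [map_deformSum, map_pow, map_zero, hs]
      exact deformSum_pow_pow injective_pow_qv hd0 hm s
    · rw [map_deformSum, map_pow, map_one, map_zero, hs]
      exact deformSum_one_pow injective_pow_qv hd0 hm s
    · rw [← Polynomial.coe_mapRingHom, map_deformSum]
      simp only [Polynomial.coe_mapRingHom, Polynomial.map_C, Polynomial.map_X, hφX]
      refine X_sub_one_sq_dvd_deformSum (m := 2 * m + 1) hd0 ?_ ?_ (by omega)
      · rw [← pow_mul, ← pow_succ', ← hm, hζ.pow_eq_one]
      · rw [← pow_mul, ← pow_succ', add_comm, hexp, hζ.pow_eq_one_iff_dvd]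
        exact dvd_mul_left _ _
  obtain ⟨f, hf⟩ := hdvd
  let g : R1 := (1 - Polynomial.X) * ∏ j ∈ range M, deformDen d (Polynomial.X : R1) 1 1 j
  have hne : ∀ i, ¬ n ∣ i → 1 - ζ ^ i ≠ 0 := fun i hi h =>
    hi ((hζ.pow_eq_one_iff_dvd i).1 (sub_eq_zero.1 h).symm)
  have hg : φ g ≠ 0 := by
    simp only [g, map_mul, map_prod, map_deformDen, map_sub, map_one, hφX]
    refine mul_ne_zero ?_ (prod_ne_zero_iff.2 fun j hj => ?_)
    · simpa using hne 1 fun h => by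
        have := Nat.le_of_dvd one_pos h
        rw [hm] at this
        nlinarith
    · obtain ⟨h1, h2, h3⟩ := not_dvd_den_exponents he he0 hm hM (mem_range.1 hj)
      rw [deformDen, mul_pow_sub_one hd0.ne', mul_one, mul_one, ← pow_succ', ← pow_two ζ,
        ← pow_mul, ← pow_mul, ← pow_mul, ← pow_add]
      exact mul_ne_zero (mul_ne_zero (mul_ne_zero (hne _ h2) (hne _ h2)) (hne _ h3)) (hne _ h1)
  have hg0 : g ≠ 0 := fun h => hg (by rw [h, map_zero])
  refine ⟨f, g, hg0, fun p hp hpg hpM => ?_, ?_⟩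
  · have hassoc : Associated p (Polynomial.cyclotomic n ℚ) :=
      hp.irreducible.associated_of_dvd (Polynomial.cyclotomic.irreducible_rat hn)
        (hp.dvd_of_dvd_pow hpM)
    exact hg (hφ' _ (hassoc.symm.dvd.trans hpg))
  · have hgK : algebraMap R1 K1 g =
        (1 - qv) * ∏ j ∈ range M, deformDen d qv 1 1 j := by
      simp only [g, map_mul, map_prod, map_deformDen, map_sub, map_one, qv]
    have hgK0 : algebraMap R1 K1 g ≠ 0 := by rwa [Ne, map_eq_zero_iff _ inj]
    rw [hgK] at hgK0
    have hden := prod_ne_zero_iff.1 (right_ne_zero_of_mul hgK0)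
    rw [hMdiv, sub_zero, hgK, ← map_mul, ← hf, map_deformSum, map_one, deformSum,
      sum_congr rfl fun k _ => term_eq qv hd0 hdeven k, ← sum_div, ← mul_assoc,
      div_mul_cancel₀ _ (left_ne_zero_of_mul hgK0)]
    exact sum_mul_prod_eq_clearedSum _ _ _ M fun j hj => hden j (mem_range.2 hj)

end
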